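/- arXiv:math/0406182 — 2 statements merged into one kernel-verified Lean document; each statement's English description precedes it below -/
import Mathlib

section
/- For every x > 0: φ⁺(x) = √(2π) · ∫_{[0,1)×[0,x)} (1−α)^{-1/2} φ((x−β)/√(1−α)) dμ(α,β). Explicitly: x e^{-x²/2} = (2π)^{-1/2} ∫₀¹ ∫₀ˣ β α^{-3/2} (1−α)^{-1/2} exp(−β²/(2α) − (x−β)²/(2(1−α))) dβ dα. -/
open MeasureTheory ProbabilityTheory Filter Set
open scoped ENNReal ProbabilityTheory Topology

/-- The standard normal density `φ(x) = (2π)^{-1/2} e^{-x²/2}`. -/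
noncomputable def gaussφ (x : ℝ) : ℝ := (Real.sqrt (2 * Real.pi))⁻¹ * Real.exp (-x ^ 2 / 2)

/-- The density `φ⁺(x) = x e^{-x²/2}` for `x ≥ 0`, and `0` for `x < 0`. -/
noncomputable def φplus (x : ℝ) : ℝ := if 0 ≤ x then x * Real.exp (-x ^ 2 / 2) else 0

/-- The random walk `S_n = X_1 + ⋯ + X_n`. -/
noncomputable def walkS {Ω : Type*} (X : ℕ → Ω → ℝ) (n : ℕ) (ω : Ω) : ℝ :=
  ∑ i ∈ Finset.range n, X (i + 1) ω

/-- The event `C_n = {S_1 > 0, …, S_n > 0}`. -/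
def posEvent {Ω : Type*} (X : ℕ → Ω → ℝ) (n : ℕ) : Set Ω :=
  {ω | ∀ k, 1 ≤ k → k ≤ n → 0 < walkS X k ω}

/-- The rescaled ladder renewal measure `μ_n` on `[0,1) × [0,∞)` (as a Borel measure on `ℝ²`):
`μ_n(A) = (1/β_n) Σ_k P((T_k/n, H_k/a_n) ∈ A)`. -/
noncomputable def ladderMeasure {Ω : Type*} [MeasureSpace Ω]
    (T : ℕ → Ω → ℕ) (H : ℕ → Ω → ℝ) (a β : ℕ → ℝ) (n : ℕ) : Measure (ℝ × ℝ) :=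
  (ENNReal.ofReal (β n))⁻¹ •
    (Measure.sum fun k =>
      Measure.map (fun ω => ((T k ω : ℝ) / (n : ℝ), H k ω / a n)) ℙ).restrict
      (Set.Ico (0 : ℝ) 1 ×ˢ Set.Ici (0 : ℝ))

/-- The limiting measure `μ` on `[0,1) × [0,∞)`, with density
`(α,β) ↦ β/(√(2π) α^{3/2}) e^{-β²/(2α)}` with respect to Lebesgue measure. -/
noncomputable def limitMeasure : Measure (ℝ × ℝ) :=
  (volume : Measure (ℝ × ℝ)).withDensity fun p =>
    ENNReal.ofReal (if 0 < p.1 ∧ p.1 < 1 ∧ 0 ≤ p.2 then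
      p.2 / (Real.sqrt (2 * Real.pi) * p.1 ^ ((3 : ℝ) / 2)) * Real.exp (-p.2 ^ 2 / (2 * p.1))
      else 0)

/-- The antiderivative `u ↦ ∫₀ᵘ e^{-v²/2} dv` of the Gaussian. -/
noncomputable def gaussPrimitive (u : ℝ) : ℝ := ∫ v in (0 : ℝ)..u, Real.exp (-(1 / 2) * v ^ 2)

lemma hasDerivAt_gaussPrimitive (u : ℝ) :
    HasDerivAt gaussPrimitive (Real.exp (-(1 / 2) * u ^ 2)) u := by
  have hc : Continuous fun v : ℝ => Real.exp (-(1 / 2) * v ^ 2) := by fun_prop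
  exact intervalIntegral.integral_hasDerivAt_right (hc.intervalIntegrable _ _)
    hc.stronglyMeasurable.stronglyMeasurableAtFilter hc.continuousAt

lemma gaussPrimitive_neg (u : ℝ) : gaussPrimitive (-u) = -gaussPrimitive u := by
  unfold gaussPrimitive
  have h := intervalIntegral.integral_comp_neg (a := 0) (b := u)
    (fun v : ℝ => Real.exp (-(1 / 2) * v ^ 2))
  simp only [neg_sq, neg_zero] at h
  rw [intervalIntegral.integral_symm, h]

lemma tendsto_gaussPrimitive_atTop :
    Tendsto gaussPrimitive atTop (𝓝 (Real.sqrt (2 * Real.pi) / 2)) := by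
  have h := intervalIntegral_tendsto_integral_Ioi (μ := volume) (0 : ℝ)
    (integrable_exp_neg_mul_sq (b := 1 / 2) (by norm_num)).integrableOn tendsto_id
  rw [integral_gaussian_Ioi, show Real.pi / (1 / 2) = 2 * Real.pi by ring] at h
  exact h

lemma tendsto_gaussPrimitive_atBot :
    Tendsto gaussPrimitive atBot (𝓝 (-(Real.sqrt (2 * Real.pi) / 2))) := by
  have h := (tendsto_gaussPrimitive_atTop.comp tendsto_neg_atBot_atTop).neg
  refine h.congr fun u => ?_
  simp [gaussPrimitive_neg]

/-- Arguments of the Gaussian antiderivatives in the closed form of the convolution in time of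
the hitting density with the heat kernel. -/
noncomputable def hittingArg (b d α : ℝ) : ℝ := (b * (1 - α) + d * α) / Real.sqrt (α * (1 - α))

lemma hasDerivAt_hittingArg (b d : ℝ) {α : ℝ} (h0 : 0 < α) (h1 : α < 1) :
    HasDerivAt (hittingArg b d)
      (-(b * (1 - α) - d * α) / (2 * Real.sqrt (α * (1 - α)) ^ 3)) α := by
  have hp : 0 < α * (1 - α) := mul_pos h0 (by linarith)
  have hr : 0 < Real.sqrt (α * (1 - α)) := Real.sqrt_pos.2 hp
  have hq : HasDerivAt (fun t : ℝ => t * (1 - t)) (1 - 2 * α) α := by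
    have := (hasDerivAt_id α).mul ((hasDerivAt_id α).const_sub 1)
    convert! this using 1
    simp; ring
  have hn : HasDerivAt (fun t : ℝ => b * (1 - t) + d * t) (d - b) α := by
    have := (((hasDerivAt_id α).const_sub 1).const_mul b).add ((hasDerivAt_id α).const_mul d)
    convert! this using 1
    simp; ring
  have h := hn.div (hq.sqrt hp.ne') hr.ne'
  convert! h using 1
  have hs : Real.sqrt (α * (1 - α)) ^ 2 = α * (1 - α) := Real.sq_sqrt hp.le
  set r := Real.sqrt (α * (1 - α))
  field_simp
  rw [hs]
  ring

lemma exp_mul_exp_hittingArg (b d : ℝ) {α : ℝ} (h0 : 0 < α) (h1 : α < 1) :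
    Real.exp (-(b - d) ^ 2 / 2) * Real.exp (-(1 / 2) * hittingArg b d α ^ 2) =
      Real.exp (-b ^ 2 / (2 * α) - d ^ 2 / (2 * (1 - α))) := by
  have h1' : 0 < 1 - α := by linarith
  rw [← Real.exp_add, hittingArg, div_pow, Real.sq_sqrt (mul_pos h0 h1').le]
  congr 1
  field_simp
  ring

lemma tendsto_hittingArg_of_pos {b d t : ℝ} {l : Filter ℝ} (hl : l ≤ 𝓝 t)
    (hI : ∀ᶠ α in l, α ∈ Ioo (0 : ℝ) 1) (ht : t * (1 - t) = 0) (hpos : 0 < b * (1 - t) + d * t) :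
    Tendsto (hittingArg b d) l atTop := by
  have hr : Tendsto (fun α : ℝ => Real.sqrt (α * (1 - α))) l (𝓝[>] 0) := by
    refine tendsto_nhdsWithin_iff.2 ⟨?_, ?_⟩
    · have hc : Continuous fun α : ℝ => Real.sqrt (α * (1 - α)) := by fun_prop
      have := (hc.tendsto t).mono_left hl
      simpa [ht] using this
    · filter_upwards [hI] with α hα
      exact Real.sqrt_pos.2 (mul_pos hα.1 (by linarith [hα.2]))
  have hn : Tendsto (fun α : ℝ => b * (1 - α) + d * α) l (𝓝 (b * (1 - t) + d * t)) := by
    have hc : Continuous fun α : ℝ => b * (1 - α) + d * α := by fun_prop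
    exact (hc.tendsto t).mono_left hl
  exact hn.pos_mul_atTop hpos (tendsto_inv_nhdsGT_zero.comp hr)

lemma hittingArg_neg (b d α : ℝ) : hittingArg (-b) (-d) α = -hittingArg b d α := by
  unfold hittingArg
  ring

lemma tendsto_hittingArg_of_neg {b d t : ℝ} {l : Filter ℝ} (hl : l ≤ 𝓝 t)
    (hI : ∀ᶠ α in l, α ∈ Ioo (0 : ℝ) 1) (ht : t * (1 - t) = 0) (hneg : b * (1 - t) + d * t < 0) :
    Tendsto (hittingArg b d) l atBot := by
  have h := tendsto_hittingArg_of_pos (b := -b) (d := -d) hl hI ht (by linarith)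
  refine (tendsto_neg_atTop_atBot.comp h).congr fun α => ?_
  simp [hittingArg_neg]

lemma integrableOn_Ioo_of_hasDerivAt_of_tendsto_of_nonneg {f f' : ℝ → ℝ} {a b fa fb : ℝ}
    (hderiv : ∀ x ∈ Ioo a b, HasDerivAt f (f' x) x) (hf' : ∀ x ∈ Ioo a b, 0 ≤ f' x)
    (ha : Tendsto f (𝓝[>] a) (𝓝 fa)) (hb : Tendsto f (𝓝[<] b) (𝓝 fb)) :
    IntegrableOn f' (Ioc a b) := by
  have hc : ContinuousOn f (Ioo a b) := fun x hx => (hderiv x hx).continuousAt.continuousWithinAt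
  refine intervalIntegral.integrableOn_deriv_of_nonneg
    (continuousOn_Icc_extendFrom_Ioo hc ha hb) (fun x hx => ?_) hf'
  refine (hderiv x hx).congr_of_eventuallyEq ?_
  filter_upwards [Ioo_mem_nhds hx.1 hx.2] with y hy
  exact extendFrom_extends hc y hy

/-- The time convolution of the Brownian hitting density of level `b` with the heat kernel,
unnormalised. -/
noncomputable def hittingKernel (b c α : ℝ) : ℝ :=
  b * (α ^ ((3 : ℝ) / 2))⁻¹ * (Real.sqrt (1 - α))⁻¹ *
    Real.exp (-b ^ 2 / (2 * α) - c ^ 2 / (2 * (1 - α)))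

lemma rpow_three_halves {α : ℝ} (h0 : 0 ≤ α) : α ^ ((3 : ℝ) / 2) = Real.sqrt α ^ 3 := by
  rw [Real.sqrt_eq_rpow, ← Real.rpow_natCast, ← Real.rpow_mul h0]
  norm_num

lemma hittingKernel_nonneg {b c α : ℝ} (hb : 0 ≤ b) (h0 : 0 ≤ α) : 0 ≤ hittingKernel b c α := by
  unfold hittingKernel
  positivity

lemma hasDerivAt_hittingKernel_primitive (b c : ℝ) {α : ℝ} (h0 : 0 < α) (h1 : α < 1) :
    HasDerivAt (fun α => -(Real.exp (-(b + c) ^ 2 / 2) * gaussPrimitive (hittingArg b (-c) α) +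
      Real.exp (-(b - c) ^ 2 / 2) * gaussPrimitive (hittingArg b c α)))
      (hittingKernel b c α) α := by
  have h := fun d : ℝ => ((hasDerivAt_gaussPrimitive (hittingArg b d α)).comp α
    (hasDerivAt_hittingArg b d h0 h1)).const_mul (Real.exp (-(b - d) ^ 2 / 2))
  have hs := ((h (-c)).add (h c)).neg
  simp only [sub_neg_eq_add] at hs
  convert! hs using 1
  have e1 := exp_mul_exp_hittingArg b (-c) h0 h1
  have e2 := exp_mul_exp_hittingArg b c h0 h1
  rw [sub_neg_eq_add, neg_sq] at e1
  rw [← mul_assoc, ← mul_assoc, e1, e2, hittingKernel, rpow_three_halves h0.le,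
    Real.sqrt_mul h0.le]
  have h1' : 0 < 1 - α := by linarith
  have hx : 0 < Real.sqrt α := Real.sqrt_pos.2 h0
  have hy : 0 < Real.sqrt (1 - α) := Real.sqrt_pos.2 h1'
  have hy2 : Real.sqrt (1 - α) ^ 2 = 1 - α := Real.sq_sqrt h1'.le
  set E := Real.exp (-b ^ 2 / (2 * α) - c ^ 2 / (2 * (1 - α)))
  generalize Real.sqrt α = u at *
  generalize Real.sqrt (1 - α) = v at *
  field_simp
  rw [hy2]
  ring

lemma tendsto_hittingKernel_primitive_zero {b c : ℝ} (hb : 0 < b) :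
    Tendsto (fun α => -(Real.exp (-(b + c) ^ 2 / 2) * gaussPrimitive (hittingArg b (-c) α) +
      Real.exp (-(b - c) ^ 2 / 2) * gaussPrimitive (hittingArg b c α))) (𝓝[>] 0)
      (𝓝 (-(Real.exp (-(b + c) ^ 2 / 2) * (Real.sqrt (2 * Real.pi) / 2) +
        Real.exp (-(b - c) ^ 2 / 2) * (Real.sqrt (2 * Real.pi) / 2)))) := by
  have h := fun d : ℝ => tendsto_gaussPrimitive_atTop.comp
    (tendsto_hittingArg_of_pos (b := b) (d := d) (t := 0) (l := 𝓝[>] 0) nhdsWithin_le_nhds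
      (Ioo_mem_nhdsGT one_pos) (by simp) (by simpa using hb))
  exact (((h (-c)).const_mul _).add ((h c).const_mul _)).neg

lemma tendsto_hittingKernel_primitive_one {b c : ℝ} (hc : 0 < c) :
    Tendsto (fun α => -(Real.exp (-(b + c) ^ 2 / 2) * gaussPrimitive (hittingArg b (-c) α) +
      Real.exp (-(b - c) ^ 2 / 2) * gaussPrimitive (hittingArg b c α))) (𝓝[<] 1)
      (𝓝 (-(Real.exp (-(b + c) ^ 2 / 2) * (-(Real.sqrt (2 * Real.pi) / 2)) +
        Real.exp (-(b - c) ^ 2 / 2) * (Real.sqrt (2 * Real.pi) / 2)))) := by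
  have h₁ := tendsto_gaussPrimitive_atBot.comp
    (tendsto_hittingArg_of_neg (b := b) (d := -c) (t := 1) (l := 𝓝[<] 1) nhdsWithin_le_nhds
      (Ioo_mem_nhdsLT one_pos) (by simp) (by simpa using hc))
  have h₂ := tendsto_gaussPrimitive_atTop.comp
    (tendsto_hittingArg_of_pos (b := b) (d := c) (t := 1) (l := 𝓝[<] 1) nhdsWithin_le_nhds
      (Ioo_mem_nhdsLT one_pos) (by simp) (by simpa using hc))
  exact ((h₁.const_mul _).add (h₂.const_mul _)).neg

lemma integrableOn_hittingKernel {b c : ℝ} (hb : 0 < b) (hc : 0 < c) :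
    IntegrableOn (hittingKernel b c) (Ioc 0 1) :=
  integrableOn_Ioo_of_hasDerivAt_of_tendsto_of_nonneg
    (fun _ hα => hasDerivAt_hittingKernel_primitive b c hα.1 hα.2)
    (fun _ hα => hittingKernel_nonneg hb.le hα.1.le)
    (tendsto_hittingKernel_primitive_zero hb) (tendsto_hittingKernel_primitive_one hc)

lemma integral_hittingKernel {b c : ℝ} (hb : 0 < b) (hc : 0 < c) :
    ∫ α in Ioo (0 : ℝ) 1, hittingKernel b c α =
      Real.sqrt (2 * Real.pi) * Real.exp (-(b + c) ^ 2 / 2) := by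
  rw [← integral_Ioc_eq_integral_Ioo, ← intervalIntegral.integral_of_le zero_le_one,
    intervalIntegral.integral_eq_sub_of_hasDerivAt_of_tendsto one_pos
      (fun _ hα => hasDerivAt_hittingKernel_primitive b c hα.1 hα.2)
      ((intervalIntegrable_iff_integrableOn_Ioc_of_le zero_le_one).2
        (integrableOn_hittingKernel hb hc))
      (tendsto_hittingKernel_primitive_zero hb) (tendsto_hittingKernel_primitive_one hc)]
  ring

lemma integrable_hittingKernel_prod (x : ℝ) :
    Integrable (fun p : ℝ × ℝ => hittingKernel p.2 (x - p.2) p.1)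
      ((volume.restrict (Ioo (0 : ℝ) 1)).prod (volume.restrict (Ioo (0 : ℝ) x))) := by
  have hm : Measurable fun p : ℝ × ℝ => hittingKernel p.2 (x - p.2) p.1 := by
    unfold hittingKernel
    fun_prop
  refine (integrable_prod_iff' hm.aestronglyMeasurable).2 ⟨?_, ?_⟩
  · filter_upwards [ae_restrict_mem (measurableSet_Ioo (a := (0 : ℝ)) (b := x))] with b hb
    have hI : IntegrableOn (hittingKernel b (x - b)) (Ioo 0 1) :=
      (integrableOn_hittingKernel hb.1 (sub_pos.2 hb.2)).mono_set Ioo_subset_Ioc_self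
    exact hI
  · have hconst : IntegrableOn (fun _ : ℝ => Real.sqrt (2 * Real.pi) * Real.exp (-x ^ 2 / 2))
        (Ioo 0 x) := integrableOn_const measure_Ioo_lt_top.ne
    refine IntegrableOn.congr_fun hconst (fun b hb => ?_) measurableSet_Ioo
    have hI := integral_hittingKernel hb.1 (sub_pos.2 hb.2)
    rw [add_sub_cancel] at hI
    refine hI.symm.trans (setIntegral_congr_fun measurableSet_Ioo fun α hα => ?_)
    exact (Real.norm_of_nonneg (hittingKernel_nonneg hb.1.le hα.1.le)).symm

lemma integral_hittingKernel_iterated {x : ℝ} (hx : 0 < x) :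
    ∫ α in Ioo (0 : ℝ) 1, ∫ b in Ioo (0 : ℝ) x, hittingKernel b (x - b) α =
      Real.sqrt (2 * Real.pi) * (x * Real.exp (-x ^ 2 / 2)) := by
  rw [integral_integral_swap (integrable_hittingKernel_prod x)]
  have h : ∀ b ∈ Ioo (0 : ℝ) x, ∫ α in Ioo (0 : ℝ) 1, hittingKernel b (x - b) α =
      Real.sqrt (2 * Real.pi) * Real.exp (-x ^ 2 / 2) := fun b hb => by
    rw [integral_hittingKernel hb.1 (sub_pos.2 hb.2), add_sub_cancel]
  rw [setIntegral_congr_fun measurableSet_Ioo h]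
  simp [hx.le]
  ring

lemma limitMeasure_integrand_eq (x : ℝ) {α b : ℝ} (hα : α ∈ Ioo (0 : ℝ) 1) (hb : 0 < b) :
    (ENNReal.ofReal (if 0 < α ∧ α < 1 ∧ 0 ≤ b then
      b / (Real.sqrt (2 * Real.pi) * α ^ ((3 : ℝ) / 2)) * Real.exp (-b ^ 2 / (2 * α))
      else 0)).toReal * ((Real.sqrt (1 - α))⁻¹ * gaussφ ((x - b) / Real.sqrt (1 - α))) =
    ((Real.sqrt (2 * Real.pi))⁻¹ * (Real.sqrt (2 * Real.pi))⁻¹) * hittingKernel b (x - b) α := by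
  have h0 := hα.1
  have h1 : 0 < 1 - α := by linarith [hα.2]
  have hp : 0 < α ^ ((3 : ℝ) / 2) := Real.rpow_pos_of_pos h0 _
  rw [if_pos ⟨hα.1, hα.2, hb.le⟩, ENNReal.toReal_ofReal (by positivity), gaussφ, hittingKernel,
    sub_eq_add_neg (-b ^ 2 / (2 * α)), Real.exp_add, neg_div 2, div_pow, Real.sq_sqrt h1.le,
    div_div, mul_comm (1 - α) 2]
  field_simp

lemma setIntegral_limitMeasure (x : ℝ) :
    ∫ p in Ico (0 : ℝ) 1 ×ˢ Ico (0 : ℝ) x,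
        (Real.sqrt (1 - p.1))⁻¹ * gaussφ ((x - p.2) / Real.sqrt (1 - p.1)) ∂limitMeasure =
      ((Real.sqrt (2 * Real.pi))⁻¹ * (Real.sqrt (2 * Real.pi))⁻¹) *
        ∫ α in Ioo (0 : ℝ) 1, ∫ b in Ioo (0 : ℝ) x, hittingKernel b (x - b) α := by
  have hset : MeasurableSet {p : ℝ × ℝ | 0 < p.1 ∧ p.1 < 1 ∧ 0 ≤ p.2} :=
    (measurableSet_lt measurable_const measurable_fst).inter
      ((measurableSet_lt measurable_fst measurable_const).inter
        (measurableSet_le measurable_const measurable_snd))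
  rw [limitMeasure, setIntegral_withDensity_eq_setIntegral_toReal_smul
    (Measurable.ennreal_ofReal (Measurable.ite hset (by fun_prop) measurable_const))
    (Eventually.of_forall fun _ => ENNReal.ofReal_lt_top) _
    (measurableSet_Ico.prod measurableSet_Ico)]
  rw [Measure.volume_eq_prod, ← Measure.prod_restrict, ← restrict_Ioo_eq_restrict_Ico,
    ← restrict_Ioo_eq_restrict_Ico, ← integral_prod _ (integrable_hittingKernel_prod x),
    ← integral_const_mul, Measure.prod_restrict]
  refine setIntegral_congr_fun (measurableSet_Ioo.prod measurableSet_Ioo) fun p hp => ?_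
  exact limitMeasure_integrand_eq x hp.1 hp.2.1

/-- equation (18) / Appendix B: for every `x > 0`,
`φ⁺(x) = √(2π) ∫_{[0,1)×[0,x)} (1−α)^{-1/2} φ((x−β)/√(1−α)) dμ(α,β)`; explicitly,
`x e^{-x²/2} = (2π)^{-1/2} ∫₀¹∫₀ˣ β α^{-3/2}(1−α)^{-1/2} exp(−β²/(2α)−(x−β)²/(2(1−α))) dβ dα`. -/
theorem phiplus_integral_identity (x : ℝ) (hx : 0 < x) :
    φplus x = Real.sqrt (2 * Real.pi) *
      ∫ p in Set.Ico (0 : ℝ) 1 ×ˢ Set.Ico (0 : ℝ) x,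
        (Real.sqrt (1 - p.1))⁻¹ * gaussφ ((x - p.2) / Real.sqrt (1 - p.1)) ∂limitMeasure ∧
    x * Real.exp (-x ^ 2 / 2) = (Real.sqrt (2 * Real.pi))⁻¹ *
      ∫ α in Set.Ioo (0 : ℝ) 1, ∫ β in Set.Ioo (0 : ℝ) x,
        β * (α ^ ((3 : ℝ) / 2))⁻¹ * (Real.sqrt (1 - α))⁻¹ *
          Real.exp (-β ^ 2 / (2 * α) - (x - β) ^ 2 / (2 * (1 - α))) := by
  have hs : Real.sqrt (2 * Real.pi) ≠ 0 := (Real.sqrt_pos.2 (by positivity)).ne'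
  have hI := integral_hittingKernel_iterated hx
  constructor
  · rw [setIntegral_limitMeasure, hI, φplus, if_pos hx.le]
    field_simp
  · simp only [hittingKernel] at hI
    rw [hI, inv_mul_cancel_left₀ hs]
end

section
/- For every x > 0: x e^{-x²/2} = (x²/√(2π)) · ∫₀¹ ∫₀¹ (w / (z^{3/2} (1−z)^{1/2})) · exp(−(x²/2)·(w²/z + (1−w)²/(1−z))) dz dw. -/
open MeasureTheory ProbabilityTheory Filter Set
open scoped ENNReal ProbabilityTheory Topology

/-- The primitive of `y ↦ exp (-c y²)` vanishing at `0`. -/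
noncomputable def gaussianPrimitive (c s : ℝ) : ℝ := ∫ y in (0 : ℝ)..s, Real.exp (-c * y ^ 2)

lemma hasDerivAt_gaussianPrimitive (c s : ℝ) :
    HasDerivAt (gaussianPrimitive c) (Real.exp (-c * s ^ 2)) s := by
  have h : Continuous fun y : ℝ => Real.exp (-c * y ^ 2) := by fun_prop
  exact (h.integral_hasStrictDerivAt 0 s).hasDerivAt

lemma gaussianPrimitive_neg (c s : ℝ) : gaussianPrimitive c (-s) = -gaussianPrimitive c s := by
  have h := intervalIntegral.integral_comp_neg (a := 0) (b := s)
    (fun y : ℝ => Real.exp (-c * y ^ 2))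
  simp only [neg_sq, neg_zero] at h
  rw [gaussianPrimitive, gaussianPrimitive, h, intervalIntegral.integral_symm]

lemma tendsto_gaussianPrimitive_atTop {c : ℝ} (hc : 0 < c) :
    Tendsto (gaussianPrimitive c) atTop (𝓝 (Real.sqrt (Real.pi / c) / 2)) := by
  rw [← integral_gaussian_Ioi]
  exact intervalIntegral_tendsto_integral_Ioi 0 (integrable_exp_neg_mul_sq hc).integrableOn
    tendsto_id

lemma tendsto_gaussianPrimitive_atBot {c : ℝ} (hc : 0 < c) :
    Tendsto (gaussianPrimitive c) atBot (𝓝 (-(Real.sqrt (Real.pi / c) / 2))) := by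
  refine ((tendsto_gaussianPrimitive_atTop hc).comp tendsto_neg_atBot_atTop).neg.congr fun s => ?_
  simp [gaussianPrimitive_neg]

/-- A primitive of the Cauchy–Schlömilch integrand `t ↦ 2 a exp (-c (a t - b / t)²)`. -/
noncomputable def schlomilchPrimitive (c a b t : ℝ) : ℝ :=
  gaussianPrimitive c (a * t - b * t⁻¹) +
    Real.exp (4 * c * a * b) * gaussianPrimitive c (a * t + b * t⁻¹)

lemma hasDerivAt_schlomilchPrimitive (c a b : ℝ) {t : ℝ} (ht : t ≠ 0) :
    HasDerivAt (schlomilchPrimitive c a b)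
      (2 * a * Real.exp (-c * (a * t - b * t⁻¹) ^ 2)) t := by
  have hi := (hasDerivAt_inv ht).const_mul b
  have ha := (hasDerivAt_id t).const_mul a
  have hu := (hasDerivAt_gaussianPrimitive c _).comp t (ha.sub hi)
  have hv := ((hasDerivAt_gaussianPrimitive c _).comp t (ha.add hi)).const_mul
    (Real.exp (4 * c * a * b))
  refine (hu.add hv).congr_deriv ?_
  have hE : Real.exp (4 * c * a * b) * Real.exp (-c * (a * t + b * t⁻¹) ^ 2) =
      Real.exp (-c * (a * t - b * t⁻¹) ^ 2) := by
    rw [← Real.exp_add]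
    congr 1
    field_simp
    ring
  simp only [Pi.add_apply, Pi.sub_apply, id]
  rw [← mul_assoc, hE]
  ring

lemma tendsto_schlomilchPrimitive_atTop {c a : ℝ} (hc : 0 < c) (ha : 0 < a) (b : ℝ) :
    Tendsto (schlomilchPrimitive c a b) atTop
      (𝓝 (Real.sqrt (Real.pi / c) / 2 +
        Real.exp (4 * c * a * b) * (Real.sqrt (Real.pi / c) / 2))) := by
  have h₁ : Tendsto (fun t : ℝ => a * t) atTop atTop := tendsto_id.const_mul_atTop ha
  have h₂ : Tendsto (fun t : ℝ => b * t⁻¹) atTop (𝓝 (b * 0)) :=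
    tendsto_inv_atTop_zero.const_mul b
  have hF := tendsto_gaussianPrimitive_atTop hc
  refine (hF.comp ?_).add ((hF.comp (h₁.atTop_add h₂)).const_mul _)
  simpa only [sub_eq_add_neg] using h₁.atTop_add h₂.neg

lemma tendsto_schlomilchPrimitive_zero {c b : ℝ} (hc : 0 < c) (a : ℝ) (hb : 0 < b) :
    Tendsto (schlomilchPrimitive c a b) (𝓝[>] 0)
      (𝓝 (-(Real.sqrt (Real.pi / c) / 2) +
        Real.exp (4 * c * a * b) * (Real.sqrt (Real.pi / c) / 2))) := by
  have h₁ : Tendsto (fun t : ℝ => a * t) (𝓝[>] 0) (𝓝 (a * 0)) :=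
    (tendsto_id.mono_left nhdsWithin_le_nhds).const_mul a
  have h₂ : Tendsto (fun t : ℝ => b * t⁻¹) (𝓝[>] 0) atTop :=
    tendsto_inv_nhdsGT_zero.const_mul_atTop hb
  refine ((tendsto_gaussianPrimitive_atBot hc).comp ?_).add
    (((tendsto_gaussianPrimitive_atTop hc).comp (h₁.add_atTop h₂)).const_mul _)
  simpa only [sub_eq_add_neg, Function.comp_def] using h₁.add_atBot (tendsto_neg_atTop_atBot.comp h₂)

lemma setIntegral_Ioo_eq_sub_of_hasDerivAt_of_nonneg {f f' : ℝ → ℝ} {a b fa fb : ℝ} (hab : a < b)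
    (hderiv : ∀ z ∈ Ioo a b, HasDerivAt f (f' z) z) (hnonneg : ∀ z ∈ Ioo a b, 0 ≤ f' z)
    (ha : Tendsto f (𝓝[>] a) (𝓝 fa)) (hb : Tendsto f (𝓝[<] b) (𝓝 fb)) :
    ∫ z in Ioo a b, f' z = fb - fa := by
  have hcont : ContinuousOn (extendFrom (Ioo a b) f) (Icc a b) :=
    continuousOn_Icc_extendFrom_Ioo
      (fun z hz => (hderiv z hz).continuousAt.continuousWithinAt) ha hb
  have hd : ∀ z ∈ Ioo a b, HasDerivAt (extendFrom (Ioo a b) f) (f' z) z := fun z hz =>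
    (hderiv z hz).congr_of_eventuallyEq <| by
      filter_upwards [isOpen_Ioo.mem_nhds hz] with y hy
      exact extendFrom_eq (subset_closure hy) (hderiv y hy).continuousAt.continuousWithinAt
  have hint := intervalIntegral.integrableOn_deriv_of_nonneg hcont hd hnonneg
  rw [← integral_Ioc_eq_integral_Ioo, ← intervalIntegral.integral_of_le hab.le]
  exact intervalIntegral.integral_eq_sub_of_hasDerivAt_of_tendsto hab hderiv
    ((intervalIntegrable_iff_integrableOn_Ioc_of_le hab.le).2 hint) ha hb

lemma hasDerivAt_sqrt_inv_sub_one {z : ℝ} (hz : z ∈ Ioo (0 : ℝ) 1) :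
    HasDerivAt (fun y : ℝ => Real.sqrt (y⁻¹ - 1))
      (-(1 / (2 * (z ^ ((3 : ℝ) / 2) * Real.sqrt (1 - z))))) z := by
  obtain ⟨h0, h1⟩ := hz
  have hpos : 0 < z⁻¹ - 1 := sub_pos.2 ((one_lt_inv₀ h0).2 h1)
  refine (((hasDerivAt_inv h0.ne').sub_const 1).sqrt hpos.ne').congr_deriv ?_
  have hz32 : z ^ ((3 : ℝ) / 2) = z * Real.sqrt z := by
    rw [Real.sqrt_eq_rpow, show (3 : ℝ) / 2 = 1 + 1 / 2 by norm_num, Real.rpow_add h0,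
      Real.rpow_one]
  have hs : Real.sqrt (z⁻¹ - 1) = Real.sqrt (1 - z) / Real.sqrt z := by
    rw [← Real.sqrt_div (sub_pos.2 h1).le]
    congr 1
    field_simp
  have hsz : 0 < Real.sqrt z := Real.sqrt_pos.2 h0
  have hs1 : 0 < Real.sqrt (1 - z) := Real.sqrt_pos.2 (sub_pos.2 h1)
  have hsq : Real.sqrt z ^ 2 = z := Real.sq_sqrt h0.le
  rw [hz32, hs]
  field_simp
  rw [hsq]

lemma sq_div_add_sq_div_eq {w z : ℝ} (hz : z ∈ Ioo (0 : ℝ) 1) :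
    w ^ 2 / z + (1 - w) ^ 2 / (1 - z) =
      1 + (w * Real.sqrt (z⁻¹ - 1) - (1 - w) * (Real.sqrt (z⁻¹ - 1))⁻¹) ^ 2 := by
  obtain ⟨h0, h1⟩ := hz
  have hpos : 0 < z⁻¹ - 1 := sub_pos.2 ((one_lt_inv₀ h0).2 h1)
  have h1z : 1 - z ≠ 0 := (sub_pos.2 h1).ne'
  have ht : Real.sqrt (z⁻¹ - 1) ≠ 0 := (Real.sqrt_pos.2 hpos).ne'
  have hsq : Real.sqrt (z⁻¹ - 1) ^ 2 = (1 - z) / z := by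
    rw [Real.sq_sqrt hpos.le]
    field_simp
  have hexp : (w * Real.sqrt (z⁻¹ - 1) - (1 - w) * (Real.sqrt (z⁻¹ - 1))⁻¹) ^ 2 =
      w ^ 2 * Real.sqrt (z⁻¹ - 1) ^ 2 - 2 * w * (1 - w) +
        (1 - w) ^ 2 / Real.sqrt (z⁻¹ - 1) ^ 2 := by
    field_simp
    ring
  rw [hexp, hsq]
  field_simp
  ring

lemma tendsto_sqrt_inv_sub_one_zero :
    Tendsto (fun y : ℝ => Real.sqrt (y⁻¹ - 1)) (𝓝[>] 0) atTop :=
  Real.tendsto_sqrt_atTop.comp (tendsto_atTop_add_const_right _ (-1) tendsto_inv_nhdsGT_zero)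

lemma tendsto_sqrt_inv_sub_one_one :
    Tendsto (fun y : ℝ => Real.sqrt (y⁻¹ - 1)) (𝓝[<] 1) (𝓝[>] 0) := by
  refine tendsto_nhdsWithin_iff.2 ⟨?_, ?_⟩
  · have h : ContinuousAt (fun y : ℝ => Real.sqrt (y⁻¹ - 1)) 1 :=
      ((continuousAt_inv₀ one_ne_zero).sub continuousAt_const).sqrt
    simpa using h.tendsto.mono_left nhdsWithin_le_nhds
  · filter_upwards [Ioo_mem_nhdsLT (zero_lt_one' ℝ)] with y hy
    exact Real.sqrt_pos.2 (sub_pos.2 ((one_lt_inv₀ hy.1).2 hy.2))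

/-- The convolution of a Brownian first-passage density with a Gaussian kernel does not depend on
how the unit distance is split into `w` and `1 - w`. -/
lemma integral_firstPassage_mul_gaussian {c w : ℝ} (hc : 0 < c) (hw : w ∈ Ioo (0 : ℝ) 1) :
    ∫ z in Ioo (0 : ℝ) 1, w / (z ^ ((3 : ℝ) / 2) * Real.sqrt (1 - z)) *
        Real.exp (-c * (w ^ 2 / z + (1 - w) ^ 2 / (1 - z))) =
      Real.exp (-c) * Real.sqrt (Real.pi / c) := by
  have hderiv : ∀ z ∈ Ioo (0 : ℝ) 1,
      HasDerivAt (fun y => -Real.exp (-c) *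
          schlomilchPrimitive c w (1 - w) (Real.sqrt (y⁻¹ - 1)))
        (w / (z ^ ((3 : ℝ) / 2) * Real.sqrt (1 - z)) *
          Real.exp (-c * (w ^ 2 / z + (1 - w) ^ 2 / (1 - z)))) z := by
    intro z hz
    have ht : Real.sqrt (z⁻¹ - 1) ≠ 0 :=
      (Real.sqrt_pos.2 (sub_pos.2 ((one_lt_inv₀ hz.1).2 hz.2))).ne'
    refine (((hasDerivAt_schlomilchPrimitive c w (1 - w) ht).comp z
      (hasDerivAt_sqrt_inv_sub_one hz)).const_mul (-Real.exp (-c))).congr_deriv ?_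
    rw [sq_div_add_sq_div_eq hz, mul_one_add, Real.exp_add]
    have h32 : z ^ ((3 : ℝ) / 2) ≠ 0 := (Real.rpow_pos_of_pos hz.1 _).ne'
    have hs1 : Real.sqrt (1 - z) ≠ 0 := (Real.sqrt_pos.2 (sub_pos.2 hz.2)).ne'
    field_simp
  have hnonneg : ∀ z ∈ Ioo (0 : ℝ) 1, 0 ≤ w / (z ^ ((3 : ℝ) / 2) * Real.sqrt (1 - z)) *
      Real.exp (-c * (w ^ 2 / z + (1 - w) ^ 2 / (1 - z))) := by
    intro z hz
    have := hw.1.le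
    have := hz.1.le
    positivity
  rw [setIntegral_Ioo_eq_sub_of_hasDerivAt_of_nonneg zero_lt_one hderiv hnonneg
    (((tendsto_schlomilchPrimitive_atTop hc hw.1 (1 - w)).comp
      tendsto_sqrt_inv_sub_one_zero).const_mul _)
    (((tendsto_schlomilchPrimitive_zero hc w (sub_pos.2 hw.2)).comp
      tendsto_sqrt_inv_sub_one_one).const_mul _)]
  ring

/-- equation (19): for every `x > 0`,
`x e^{-x²/2} = (x²/√(2π)) ∫₀¹∫₀¹ (w/(z^{3/2}(1−z)^{1/2})) exp(−(x²/2)(w²/z+(1−w)²/(1−z))) dz dw`. -/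
theorem gaussian_double_integral_identity (x : ℝ) (hx : 0 < x) :
    x * Real.exp (-x ^ 2 / 2) = x ^ 2 / Real.sqrt (2 * Real.pi) *
      ∫ w in Set.Ioo (0 : ℝ) 1, ∫ z in Set.Ioo (0 : ℝ) 1,
        w / (z ^ ((3 : ℝ) / 2) * Real.sqrt (1 - z)) *
          Real.exp (-(x ^ 2 / 2) * (w ^ 2 / z + (1 - w) ^ 2 / (1 - z))) := by
  have hc : 0 < x ^ 2 / 2 := by positivity
  rw [setIntegral_congr_fun measurableSet_Ioo
    fun w hw => integral_firstPassage_mul_gaussian hc hw]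
  have hsqrt : Real.sqrt (Real.pi / (x ^ 2 / 2)) = Real.sqrt (2 * Real.pi) / x := by
    rw [← Real.sqrt_sq hx.le, ← Real.sqrt_div (by positivity), Real.sqrt_sq hx.le]
    congr 1
    field_simp
  have hpi : 0 < Real.sqrt (2 * Real.pi) := Real.sqrt_pos.2 (by positivity)
  rw [hsqrt, setIntegral_const, neg_div]
  simp only [measureReal_def, Real.volume_Ioo, sub_zero, ENNReal.toReal_ofReal zero_le_one,
    one_smul]
  field_simp
end
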